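/- Let c ∈ ℝ⁴ be a base quadruple of a bounded Apollonian packing and let s ∈ ℝ⁴. If for every w ∈ W* the vector w·s has exactly three positive coordinates and one negative coordinate, then the family (exp(−⟨w·c, s⟩))_{w ∈ W} is not summable. -/

import Mathlib

open Finset Complex

noncomputable section

/-- The Descartes quadratic form `F(x) = 2(x₁²+x₂²+x₃²+x₄²) − (x₁+x₂+x₃+x₄)²`. -/
def DescartesF (x : Fin 4 → ℝ) : ℝ := 2 * (∑ i, (x i)^2) - (∑ i, x i)^2

/-- Height of a vector: the sum of its coordinates. -/
def ht (x : Fin 4 → ℝ) : ℝ := ∑ i, x i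

/-- The Apollonian reflection as a linear map: it replaces the `i`-th coordinate `xᵢ`
by `2(Σ_{j≠i} xⱼ) − xᵢ = 2(Σ_j xⱼ) − 3xᵢ` and fixes the other coordinates. -/
def sigmaL (i : Fin 4) : (Fin 4 → ℝ) →ₗ[ℝ] (Fin 4 → ℝ) where
  toFun x := Function.update x i (2 * (∑ j, x j) - 3 * x i)
  map_add' x y := by
    funext j
    rcases eq_or_ne j i with h | h
    · subst h; simp [Function.update_self, Finset.sum_add_distrib]; ring
    · simp [Function.update_of_ne h]
  map_smul' r x := by
    funext j
    rcases eq_or_ne j i with h | h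
    · subst h
      simp only [Pi.smul_apply, smul_eq_mul, Function.update_self, RingHom.id_apply]
      rw [← Finset.mul_sum]
      ring
    · simp [Function.update_of_ne h]

lemma sigmaL_invol (i : Fin 4) : Function.Involutive (sigmaL i) := by
  intro x
  funext j
  have hsum : ∑ k, Function.update x i (2 * (∑ j, x j) - 3 * x i) k
      = 3 * (∑ k, x k) - 4 * x i := by
    rw [Finset.sum_update_of_mem (Finset.mem_univ i)]
    have : ∑ k ∈ Finset.univ \ {i}, x k = (∑ k, x k) - x i := by
      rw [Finset.sum_sdiff_eq_sub (Finset.subset_univ _), Finset.sum_singleton]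
    rw [this]; ring
  rcases eq_or_ne j i with h | h
  · subst h
    simp only [sigmaL, LinearMap.coe_mk, AddHom.coe_mk, Function.update_self, hsum]
    ring
  · simp [sigmaL, Function.update_of_ne h]

/-- The Apollonian reflection `σᵢ` as a linear automorphism of `ℝ⁴`. -/
def apSigma (i : Fin 4) : (Fin 4 → ℝ) ≃ₗ[ℝ] (Fin 4 → ℝ) :=
  LinearEquiv.ofInvolutive (sigmaL i) (sigmaL_invol i)

/-- The Apollonian group `W`, generated by the four reflections `σ₁, σ₂, σ₃, σ₄`. -/
def apW : Subgroup ((Fin 4 → ℝ) ≃ₗ[ℝ] (Fin 4 → ℝ)) :=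
  Subgroup.closure {apSigma 0, apSigma 1, apSigma 2, apSigma 3}

/-- The pairing `⟨x,s⟩ = x₁s₁+x₂s₂+x₃s₃+x₄s₄` of real vectors. -/
def pairR (x s : Fin 4 → ℝ) : ℝ := ∑ i, x i * s i

/-- `c` is a base quadruple of a bounded Apollonian packing: `F(c) = 0`, exactly one
coordinate of `c` is negative, and `2cᵢ ≤ ht(c)` for every `i`. -/
def IsBaseQuadruple (c : Fin 4 → ℝ) : Prop :=
  DescartesF c = 0 ∧ (∃! i, c i < 0) ∧ ∀ i, 2 * c i ≤ ht c

/-- The dual Apollonian reflection as a linear map: it sends `s` to the vector with `i`-th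
coordinate `−sᵢ` and `j`-th coordinate `sⱼ + 2sᵢ` for `j ≠ i`. -/
def tauL (i : Fin 4) : (Fin 4 → ℝ) →ₗ[ℝ] (Fin 4 → ℝ) where
  toFun s := fun j => if j = i then -s i else s j + 2 * s i
  map_add' x y := by
    funext j
    rcases eq_or_ne j i with h | h <;> simp [h] <;> ring
  map_smul' r x := by
    funext j
    rcases eq_or_ne j i with h | h <;> simp [h] <;> ring

lemma tauL_invol (i : Fin 4) : Function.Involutive (tauL i) := by
  intro x
  funext j
  rcases eq_or_ne j i with h | h <;> simp [tauL, h] <;> ring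

/-- The dual Apollonian reflection `τᵢ` (the transpose of `σᵢ`) as a linear automorphism. -/
def apTau (i : Fin 4) : (Fin 4 → ℝ) ≃ₗ[ℝ] (Fin 4 → ℝ) :=
  LinearEquiv.ofInvolutive (tauL i) (tauL_invol i)

/-- The dual Apollonian group `W* = ⟨τ₁, τ₂, τ₃, τ₄⟩`. -/
def apWstar : Subgroup ((Fin 4 → ℝ) ≃ₗ[ℝ] (Fin 4 → ℝ)) :=
  Subgroup.closure {apTau 0, apTau 1, apTau 2, apTau 3}

lemma pairR_sigma (i : Fin 4) (x y : Fin 4 → ℝ) :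
    pairR (apSigma i x) y = pairR x y + y i * (2 * ht x - 4 * x i) := by
  fin_cases i <;>
    simp [pairR, ht, apSigma, sigmaL, Fin.sum_univ_four, Function.update] <;> ring

lemma pairR_sigma_tau (i : Fin 4) (x y : Fin 4 → ℝ) :
    pairR (apSigma i x) y = pairR x (apTau i y) := by
  rw [pairR_sigma]
  fin_cases i <;>
    simp [pairR, ht, apTau, tauL, Fin.sum_univ_four] <;> ring

lemma apSigma_mem (i : Fin 4) : apSigma i ∈ apW := by
  apply Subgroup.subset_closure
  fin_cases i <;> simp

lemma apTau_mem (i : Fin 4) : apTau i ∈ apWstar := by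
  apply Subgroup.subset_closure
  fin_cases i <;> simp

lemma exists_adjoint (w : (Fin 4 → ℝ) ≃ₗ[ℝ] (Fin 4 → ℝ)) (hw : w ∈ apW) :
    ∃ t ∈ apWstar, ∀ x y, pairR (w x) y = pairR x (t y) := by
  unfold apW at hw
  induction hw using Subgroup.closure_induction with
  | mem a ha =>
    have : ∃ i, a = apSigma i := by
      rcases ha with h | h | h | h <;> exact ⟨_, h⟩
    obtain ⟨i, rfl⟩ := this
    exact ⟨apTau i, apTau_mem i, pairR_sigma_tau i⟩
  | one => exact ⟨1, one_mem _, fun x y => rfl⟩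
  | mul a b _ _ iha ihb =>
    obtain ⟨t, ht, h1⟩ := iha
    obtain ⟨u, hu, h2⟩ := ihb
    refine ⟨u * t, mul_mem hu ht, fun x y => ?_⟩
    rw [LinearEquiv.mul_apply, LinearEquiv.mul_apply, h1, h2]
  | inv a _ iha =>
    obtain ⟨t, ht, h1⟩ := iha
    refine ⟨t⁻¹, inv_mem ht, fun x y => ?_⟩
    have := h1 (a⁻¹ x) (t⁻¹ y)
    rw [← LinearEquiv.mul_apply, ← LinearEquiv.mul_apply, mul_inv_cancel, mul_inv_cancel] at this
    exact this.symm

/-- If every `W*`-translate of `s` has exactly three positive coordinates and one negative,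
then `Z(s)` diverges. -/
theorem not_summable_of_three_pos_one_neg (c : Fin 4 → ℝ) (hc : IsBaseQuadruple c)
    (s : Fin 4 → ℝ)
    (h : ∀ w ∈ apWstar, ∃ i : Fin 4, (w : (Fin 4 → ℝ) ≃ₗ[ℝ] (Fin 4 → ℝ)) s i < 0 ∧
      ∀ j : Fin 4, j ≠ i → 0 < (w : (Fin 4 → ℝ) ≃ₗ[ℝ] (Fin 4 → ℝ)) s j) :
    ¬ Summable fun w : apW => Real.exp (-pairR ((w : (Fin 4 → ℝ) ≃ₗ[ℝ] (Fin 4 → ℝ)) c) s) := by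
  intro hs
  have hfin : {w : apW | Real.exp (-pairR c s) ≤
      Real.exp (-pairR ((w : (Fin 4 → ℝ) ≃ₗ[ℝ] (Fin 4 → ℝ)) c) s)}.Finite := by
    have h1 := hs.tendsto_cofinite_zero.eventually (gt_mem_nhds (Real.exp_pos (-pairR c s)))
    rw [Filter.eventually_cofinite] at h1
    simpa using h1
  have hne : {w : apW | Real.exp (-pairR c s) ≤
      Real.exp (-pairR ((w : (Fin 4 → ℝ) ≃ₗ[ℝ] (Fin 4 → ℝ)) c) s)}.Nonempty :=
    ⟨1, by simp⟩
  obtain ⟨w, hw, hmin⟩ := Set.exists_min_image _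
    (fun w : apW => pairR ((w : (Fin 4 → ℝ) ≃ₗ[ℝ] (Fin 4 → ℝ)) (fun _ => 1)) s) hfin hne
  obtain ⟨t, htm, hadj⟩ := exists_adjoint w.1 w.2
  obtain ⟨i, hi, -⟩ := h t htm
  have key : ∀ x, pairR ((w.1 * apSigma i) x) s =
      pairR (w.1 x) s + (t s) i * (2 * ht x - 4 * x i) := by
    intro x
    rw [LinearEquiv.mul_apply, hadj, pairR_sigma, hadj]
  have h1 := hmin (w * ⟨apSigma i, apSigma_mem i⟩) (by
    have hc' := hc.2.2 i
    have k := key c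
    simp only [Set.mem_setOf_eq, Real.exp_le_exp] at hw ⊢
    rw [Subgroup.coe_mul, k]
    nlinarith)
  have k := key (fun _ => 1)
  simp only [Subgroup.coe_mul] at h1
  rw [k] at h1
  have h4 : ht (fun _ => (1 : ℝ)) = 4 := by simp [ht]
  rw [h4] at h1
  linarith
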